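/- arXiv:1704.05809 — 2 statements merged into one kernel-verified Lean document; each statement's English description precedes it below -/
import Mathlib

section
/- Schur's pfaffian identity: for distinct variables x_1, …, x_{2n} with all x_i + x_j ≠ 0, the pfaffian of the 2n × 2n antisymmetric matrix with (i,j) entry (x_i − x_j)/(x_i + x_j) for i < j equals the product ∏_{1 ≤ i < j ≤ 2n} (x_i − x_j)/(x_i + x_j). -/
/-!
Statement 4: Schur's pfaffian identity.  The pfaffian is defined by the sum formula
`pf A = (1/(2^n n!)) Σ_{σ ∈ S_{2n}} sgn(σ) ∏_i A_{σ(2i−1) σ(2i)}`.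
-/

/-- The pfaffian of a `2n × 2n` matrix, via the permutation-sum formula. -/
noncomputable def pf {n : ℕ} (A : Matrix (Fin (2 * n)) (Fin (2 * n)) ℂ) : ℂ :=
  ((2 ^ n * n.factorial : ℕ) : ℂ)⁻¹ *
    ∑ σ : Equiv.Perm (Fin (2 * n)), ((Equiv.Perm.sign σ : ℤ) : ℂ) *
      ∏ i : Fin n,
        A (σ ⟨2 * i.1, by have := i.2; omega⟩) (σ ⟨2 * i.1 + 1, by have := i.2; omega⟩)

open Finset Polynomial

section PartialFractions

variable {ι K : Type*} [Fintype ι] [DecidableEq ι] [Field K]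

/-- The product `∏_{c ≠ a} (x_a + x_c) / (x_a - x_c)`. -/
def schurWeight (x : ι → K) (a : ι) : K :=
  ∏ c ∈ univ.erase a, (x a + x c) / (x a - x c)

theorem prod_erase_add_mul_nodalWeight {x : ι → K} (hsum : ∀ i j, x i + x j ≠ 0) (a b : ι) :
    (∏ c ∈ univ.erase b, (x a + x c)) * Lagrange.nodalWeight univ x a =
      2 * x a * schurWeight x a / (x a + x b) := by
  rw [eq_div_iff (hsum a b), mul_right_comm, prod_erase_mul _ _ (mem_univ b),
    ← mul_prod_erase _ _ (mem_univ a), schurWeight, Lagrange.nodalWeight, mul_assoc,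
    ← prod_mul_distrib, two_mul]
  simp only [div_eq_mul_inv]

theorem degree_prod_erase_X_add_C (x : ι → K) (b : ι) :
    (∏ c ∈ univ.erase b, (X + C (x c))).degree < (#(univ : Finset ι) : WithBot ℕ) := by
  rw [degree_prod]
  simp only [degree_X_add_C, sum_const, card_erase_of_mem (mem_univ b), nsmul_eq_mul, mul_one]
  have : 0 < #(univ : Finset ι) := card_pos.mpr ⟨b, mem_univ b⟩
  exact_mod_cast Nat.sub_lt this one_pos

theorem sum_schurWeight_div {x : ι → K} (hx : Function.Injective x)
    (hsum : ∀ i j, x i + x j ≠ 0) (b : ι) :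
    ∑ a, 2 * x a * schurWeight x a / (x a + x b) = 1 := by
  have h := Lagrange.coeff_eq_sum (s := univ) (v := x) hx.injOn (degree_prod_erase_X_add_C x b)
  have hm : (∏ c ∈ univ.erase b, (X + C (x c))).Monic :=
    monic_prod_of_monic _ _ fun c _ => monic_X_add_C _
  have hd : (∏ c ∈ univ.erase b, (X + C (x c))).natDegree = #(univ : Finset ι) - 1 := by
    rw [natDegree_prod_of_monic _ _ fun c _ => monic_X_add_C _]
    simp [card_erase_of_mem]
  rw [← hd, hm.coeff_natDegree] at h
  rw [h]
  refine sum_congr rfl fun a _ => ?_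
  rw [← prod_erase_add_mul_nodalWeight hsum, Lagrange.nodalWeight, eval_prod, div_eq_mul_inv,
    prod_inv_distrib]
  simp

theorem prod_erase_add_eq_sum {x : ι → K} (hx : Function.Injective x)
    (hsum : ∀ i j, x i + x j ≠ 0) (b : ι) {z : K} (hz : ∀ i, z ≠ x i) :
    ∏ c ∈ univ.erase b, (z + x c) =
      (∏ c, (z - x c)) * ∑ a, 2 * x a * schurWeight x a / (x a + x b) / (z - x a) := by
  have h := congrArg (eval z)
    (Lagrange.eq_interpolate (s := univ) (v := x) hx.injOn (degree_prod_erase_X_add_C x b))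
  rw [Lagrange.eval_interpolate_not_at_node _ fun i _ => hz i, Lagrange.eval_nodal] at h
  simp only [eval_prod, eval_add, eval_X, eval_C] at h
  rw [h]
  congr 1
  refine sum_congr rfl fun a _ => ?_
  rw [← prod_erase_add_mul_nodalWeight hsum]
  ring

theorem sum_schurWeight_eq_zero {x : ι → K} (hx : Function.Injective x)
    (hsum : ∀ i j, x i + x j ≠ 0) (heven : Even (Fintype.card ι)) :
    ∑ a, schurWeight x a = 0 := by
  rcases isEmpty_or_nonempty ι with _ | ⟨⟨b⟩⟩
  · simp
  have h2 : (2 : K) ≠ 0 := fun h => hsum b b (by rw [← two_mul, h, zero_mul])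
  have h0 : ∀ i, x i ≠ 0 := fun i h => hsum i i (by rw [h, add_zero])
  have h := prod_erase_add_eq_sum hx hsum b (z := 0) fun i => (h0 i).symm
  simp only [zero_add, zero_sub, prod_neg, card_univ, heven.neg_one_pow, one_mul] at h
  rw [← prod_erase_mul _ _ (mem_univ b), mul_assoc] at h
  have hp : ∏ c ∈ univ.erase b, x c ≠ 0 := prod_ne_zero_iff.mpr fun c _ => h0 c
  have h' := mul_left_cancel₀ hp ((mul_one _).trans h)
  have h1 := sum_schurWeight_div hx hsum b
  refine (mul_eq_zero.mp (?_ : 2 * ∑ a, schurWeight x a = 0)).resolve_left h2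
  rw [← sub_self (1 : K)]
  nth_rw 1 [← h1]
  rw [h', mul_sum, mul_sum, ← sum_sub_distrib]
  refine sum_congr rfl fun a _ => ?_
  have := h0 a
  have := hsum a b
  field_simp
  ring

theorem schurWeight_mul_sum {x : ι → K} (hx : Function.Injective x)
    (hsum : ∀ i j, x i + x j ≠ 0) (heven : Even (Fintype.card ι)) (b : ι) :
    schurWeight x b * ∑ a, 4 * x a * x b * schurWeight x a / (x a + x b) ^ 2 = 1 := by
  have h := prod_erase_add_eq_sum hx hsum b (z := -x b)
    fun i h => hsum i b (by rw [← h, neg_add_cancel])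
  have hodd : Odd (#(univ.erase b)) := by
    rw [card_erase_of_mem (mem_univ b), card_univ]
    exact Nat.Even.sub_odd (Fintype.card_pos_iff.mpr ⟨b⟩) heven odd_one
  have e1 : ∏ c ∈ univ.erase b, (-x b + x c) = -∏ c ∈ univ.erase b, (x b - x c) := by
    rw [prod_congr rfl fun c _ => show -x b + x c = -(x b - x c) by ring, prod_neg,
      hodd.neg_one_pow, neg_one_mul]
  have e2 : ∏ c, (-x b - x c) = 2 * x b * ∏ c ∈ univ.erase b, (x b + x c) := by
    rw [two_mul, mul_prod_erase univ (fun c => x b + x c) (mem_univ b),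
      prod_congr rfl fun c _ => show -x b - x c = -(x b + x c) by ring, prod_neg, card_univ,
      heven.neg_one_pow, one_mul]
  have hp : ∏ c ∈ univ.erase b, (x b - x c) ≠ 0 := prod_ne_zero_iff.mpr fun c hc =>
    sub_ne_zero.mpr fun h => (mem_erase.mp hc).1 (hx h).symm
  have e3 : 2 * x b * ∑ a, 2 * x a * schurWeight x a / (x a + x b) / (-x b - x a) =
      -∑ a, 4 * x a * x b * schurWeight x a / (x a + x b) ^ 2 := by
    rw [mul_sum, ← sum_neg_distrib]
    refine sum_congr rfl fun a _ => ?_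
    rw [show -x b - x a = -(x a + x b) by ring]
    have := hsum a b
    field_simp
    ring
  rw [e1, e2] at h
  have e4 : schurWeight x b =
      (∏ c ∈ univ.erase b, (x b + x c)) / ∏ c ∈ univ.erase b, (x b - x c) := prod_div_distrib ..
  rw [e4, div_mul_eq_mul_div, div_eq_one_iff_eq hp]
  linear_combination h + (∏ c ∈ univ.erase b, (x b + x c)) * e3

theorem sum_sum_schurWeight {x : ι → K} (hx : Function.Injective x)
    (hsum : ∀ i j, x i + x j ≠ 0) (heven : Even (Fintype.card ι)) :
    ∑ a, ∑ b, schurWeight x a * schurWeight x b * ((x a - x b) / (x a + x b)) ^ 2 =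
      -(Fintype.card ι : K) := by
  have key (b : ι) : ∑ a, schurWeight x a * schurWeight x b *
      ((x a - x b) / (x a + x b)) ^ 2 = -1 := by
    have h : ∑ a, schurWeight x a * schurWeight x b * ((x a - x b) / (x a + x b)) ^ 2 =
        schurWeight x b * ∑ a, schurWeight x a -
          schurWeight x b * ∑ a, 4 * x a * x b * schurWeight x a / (x a + x b) ^ 2 := by
      rw [mul_sum, mul_sum, ← sum_sub_distrib]
      refine sum_congr rfl fun a _ => ?_
      have := hsum a b
      field_simp
      ring
    rw [h, schurWeight_mul_sum hx hsum heven, sum_schurWeight_eq_zero hx hsum heven, mul_zero,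
      zero_sub]
  rw [sum_comm, sum_congr rfl fun b _ => key b]
  simp

end PartialFractions

section Symmetrization

variable {K : Type*} [Field K]

theorem sum_perm_comp_succ {α M : Type*} [AddCommMonoid M] {n : ℕ} (x : Fin (n + 1) → α)
    (g : (Fin (n + 1) → α) → M) :
    ∑ σ : Equiv.Perm (Fin (n + 1)), g (x ∘ σ) =
      ∑ p, ∑ e : Equiv.Perm (Fin n),
        g (Fin.cons (x p) ((fun i => x (Equiv.swap 0 p i.succ)) ∘ e)) := by
  rw [← Equiv.Perm.decomposeFin.symm.sum_comp, Fintype.sum_prod_type]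
  refine sum_congr rfl fun p _ => sum_congr rfl fun e _ => congrArg g ?_
  ext i
  cases i using Fin.cases <;> simp

@[to_additive]
theorem prod_comp_swap_zero {M : Type*} [CommMonoid M] {n : ℕ} (f : Fin (n + 1) → M)
    (p : Fin (n + 1)) : f p * ∏ i : Fin n, f (Equiv.swap 0 p i.succ) = ∏ i, f i := by
  rw [← Equiv.prod_comp (Equiv.swap 0 p) f, Fin.prod_univ_succ, Equiv.swap_apply_left]

/-- The Schur product `∏_{i < j} (y_i - y_j) / (y_i + y_j)`. -/
def schurProd {N : ℕ} (y : Fin N → K) : K :=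
  ∏ i, ∏ j ∈ Ioi i, (y i - y j) / (y i + y j)

/-- The product `∏_i (y_{2i} - y_{2i+1}) / (y_{2i} + y_{2i+1})` over consecutive pairs. -/
def pairProd {n : ℕ} (y : Fin (2 * n) → K) : K :=
  ∏ i : Fin n, (y ⟨2 * i.1, by omega⟩ - y ⟨2 * i.1 + 1, by omega⟩) /
    (y ⟨2 * i.1, by omega⟩ + y ⟨2 * i.1 + 1, by omega⟩)

theorem schurProd_cons {N : ℕ} (a : K) (y : Fin N → K) :
    schurProd (Fin.cons a y : Fin (N + 1) → K) =
      (∏ j, (a - y j) / (a + y j)) * schurProd y := by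
  simp only [schurProd]
  rw [Fin.prod_univ_succ, Fin.prod_Ioi_zero]
  simp only [Fin.prod_Ioi_succ, Fin.cons_zero, Fin.cons_succ]

theorem pairProd_cons_cons {n : ℕ} (a b : K) (y : Fin (2 * n) → K) :
    pairProd (n := n + 1) (Fin.cons a (Fin.cons b y : Fin (2 * n + 1) → K)) =
      (a - b) / (a + b) * pairProd y := by
  rw [pairProd, Fin.prod_univ_succ]
  rfl

theorem schurProd_comp_perm {N : ℕ} (y : Fin N → K) (σ : Equiv.Perm (Fin N)) :
    schurProd (y ∘ σ) = σ.sign * schurProd y :=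
  σ.prod_Ioi_comp_eq_sign_mul_prod (f := fun i j => (y i - y j) / (y i + y j))
    fun i j => by rw [← neg_div, neg_sub, add_comm]

theorem schurProd_ne_zero {N : ℕ} {y : Fin N → K} (hy : Function.Injective y)
    (hsum : ∀ i j, y i + y j ≠ 0) : schurProd y ≠ 0 :=
  prod_ne_zero_iff.mpr fun i _ => prod_ne_zero_iff.mpr fun j hj =>
    div_ne_zero (sub_ne_zero.mpr fun h => (mem_Ioi.mp hj).ne (hy h)) (hsum i j)

theorem inv_schurProd_mul_pairProd_cons_cons {n : ℕ} {a b : K} (hab : a ≠ b) (hab' : a + b ≠ 0)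
    (y : Fin (2 * n) → K) :
    (schurProd (Fin.cons a (Fin.cons b y : Fin (2 * n + 1) → K) : Fin (2 * n + 2) → K))⁻¹ *
      pairProd (n := n + 1) (Fin.cons a (Fin.cons b y : Fin (2 * n + 1) → K)) =
    (∏ j, (a + y j) / (a - y j)) * (∏ j, (b + y j) / (b - y j)) *
      ((schurProd y)⁻¹ * pairProd y) := by
  rw [schurProd_cons, schurProd_cons, pairProd_cons_cons, Fin.prod_univ_succ]
  simp only [Fin.cons_zero, Fin.cons_succ, mul_inv, ← prod_inv_distrib, inv_div]
  have := sub_ne_zero.mpr hab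
  field_simp

theorem schurWeight_eq_prod_ite [DecidableEq K] {ι : Type*} [Fintype ι] [DecidableEq ι] {x : ι → K}
    (hx : Function.Injective x) (a : ι) :
    schurWeight x a = ∏ c, if x c = x a then 1 else (x a + x c) / (x a - x c) := by
  rw [← mul_prod_erase _ _ (mem_univ a), if_pos rfl, one_mul, schurWeight]
  exact prod_congr rfl fun c hc => (if_neg (hx.ne (mem_erase.mp hc).1)).symm

theorem comp_swap_zero_succ_injective {α : Type*} {n : ℕ} {x : Fin (n + 1) → α}
    (hx : Function.Injective x) (p : Fin (n + 1)) :
    Function.Injective fun i : Fin n => x (Equiv.swap 0 p i.succ) :=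
  hx.comp ((Equiv.injective _).comp (Fin.succ_injective n))

theorem comp_swap_zero_succ_ne {α : Type*} {n : ℕ} {x : Fin (n + 1) → α}
    (hx : Function.Injective x) (p : Fin (n + 1)) (i : Fin n) :
    x (Equiv.swap 0 p i.succ) ≠ x p := by
  refine hx.ne fun h => Fin.succ_ne_zero i ((Equiv.swap 0 p).injective ?_)
  rw [h, Equiv.swap_apply_left]

theorem schurWeight_mul_schurWeight {n : ℕ} {x : Fin (n + 2) → K} (hx : Function.Injective x)
    (p : Fin (n + 2)) (q : Fin (n + 1)) {a b : K} {z : Fin n → K} (ha : x p = a)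
    (hb : x (Equiv.swap 0 p q.succ) = b)
    (hz : ∀ i, x (Equiv.swap 0 p (Equiv.swap 0 q i.succ).succ) = z i) :
    schurWeight x p * schurWeight x (Equiv.swap 0 p q.succ) =
      (a + b) / (a - b) * (∏ i, (a + z i) / (a - z i)) *
        ((b + a) / (b - a) * ∏ i, (b + z i) / (b - z i)) := by
  classical
  have hprod (f : K → K) : ∏ c, f (x c) = f a * (f b * ∏ i, f (z i)) := by
    rw [← prod_comp_swap_zero (fun c => f (x c)) p,
      ← prod_comp_swap_zero (fun i => f (x (Equiv.swap 0 p i.succ))) q]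
    simp only [ha, hb, hz]
  have hba : b ≠ a := ha ▸ hb ▸ comp_swap_zero_succ_ne hx p q
  have hza (i : Fin n) : z i ≠ a := ha ▸ hz i ▸ comp_swap_zero_succ_ne hx p _
  have hzb (i : Fin n) : z i ≠ b :=
    hb ▸ hz i ▸ comp_swap_zero_succ_ne (comp_swap_zero_succ_injective hx p) q i
  rw [schurWeight_eq_prod_ite hx, schurWeight_eq_prod_ite hx, ha, hb,
    hprod fun v => if v = a then 1 else (a + v) / (a - v),
    hprod fun v => if v = b then 1 else (b + v) / (b - v)]
  simp only [if_neg hba, if_neg hba.symm, if_neg (hza _), if_neg (hzb _), if_true, one_mul]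

theorem sum_perm_inv_schurProd_mul_pairProd (n : ℕ) (x : Fin (2 * n) → K)
    (hx : Function.Injective x) (hsum : ∀ i j, x i + x j ≠ 0) :
    ∑ σ : Equiv.Perm (Fin (2 * n)), (schurProd (x ∘ σ))⁻¹ * pairProd (x ∘ σ) =
      ((2 ^ n * n.factorial : ℕ) : K) := by
  induction n with
  | zero => simp [schurProd, pairProd]
  | succ n ih =>
    change ∑ σ : Equiv.Perm (Fin (2 * n + 1 + 1)), (schurProd (N := 2 * n + 1 + 1) (x ∘ σ))⁻¹ *
      pairProd (n := n + 1) (x ∘ σ) = _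
    change Fin (2 * n + 1 + 1) → K at x
    rw [sum_perm_comp_succ x fun y => (schurProd y)⁻¹ * pairProd (n := n + 1) y]
    have inner (p : Fin (2 * n + 1 + 1)) : ∑ e : Equiv.Perm (Fin (2 * n + 1)),
        (schurProd (Fin.cons (x p) ((fun i => x (Equiv.swap 0 p i.succ)) ∘ e) :
          Fin (2 * n + 1 + 1) → K))⁻¹ *
        pairProd (n := n + 1) (Fin.cons (x p) ((fun i => x (Equiv.swap 0 p i.succ)) ∘ e)) =
        ((2 ^ n * n.factorial : ℕ) : K) * ∑ q,
          -(schurWeight x p * schurWeight x q * ((x p - x q) / (x p + x q)) ^ 2) := by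
      rw [← sum_comp_swap_zero _ p, sub_self, zero_div, zero_pow two_ne_zero, mul_zero, neg_zero,
        zero_add, mul_sum]
      rw [sum_perm_comp_succ _ fun y : Fin (2 * n + 1) → K =>
        (schurProd (Fin.cons (x p) y : Fin (2 * n + 1 + 1) → K))⁻¹ *
          pairProd (n := n + 1) (Fin.cons (x p) y)]
      refine sum_congr rfl fun q _ => ?_
      obtain ⟨z, hz⟩ : ∃ z : Fin (2 * n) → K,
          z = fun i => x (Equiv.swap 0 p (Equiv.swap 0 q i.succ).succ) := ⟨_, rfl⟩
      have hW := schurWeight_mul_schurWeight hx p q rfl rfl fun i => (congrFun hz i).symm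
      have hih := ih _ (comp_swap_zero_succ_injective (comp_swap_zero_succ_injective hx p) q)
        fun i j => hsum _ _
      have hpq := (comp_swap_zero_succ_ne hx p q).symm
      have hpq' : x p + x (Equiv.swap 0 p q.succ) ≠ 0 := hsum _ _
      rw [hW, ← hz]
      rw [← hz] at hih
      generalize x p = a at *
      generalize x (Equiv.swap 0 p q.succ) = b at *
      simp only [inv_schurProd_mul_pairProd_cons_cons hpq hpq']
      have hperm (b : K) (e : Equiv.Perm (Fin (2 * n))) :
          ∏ j, (b + (z ∘ e) j) / (b - (z ∘ e) j) = ∏ j, (b + z j) / (b - z j) :=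
        Equiv.prod_comp e fun j => (b + z j) / (b - z j)
      simp only [hperm]
      rw [← mul_sum, hih]
      have h1 := sub_ne_zero.mpr hpq
      have h2 := sub_ne_zero.mpr hpq.symm
      have h3 : b + a ≠ 0 := add_comm a b ▸ hpq'
      field_simp
      ring
    rw [sum_congr rfl fun p _ => inner p, ← mul_sum]
    simp only [sum_neg_distrib]
    rw [sum_sum_schurWeight (x := x) hx hsum (by simp [parity_simps]), neg_neg, Fintype.card_fin,
      Nat.factorial_succ]
    push_cast
    ring

end Symmetrization

/-- Schur's pfaffian identity: for distinct `x₁, …, x_{2n}` with all `x_i + x_j ≠ 0`,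
the pfaffian of the antisymmetric matrix with entries `(x_i − x_j)/(x_i + x_j)`
equals `∏_{i<j} (x_i − x_j)/(x_i + x_j)`. -/
theorem schur_pfaffian (n : ℕ) (x : Fin (2 * n) → ℂ)
    (hdist : ∀ i j, i ≠ j → x i ≠ x j) (hsum : ∀ i j, x i + x j ≠ 0) :
    pf (Matrix.of fun i j => (x i - x j) / (x i + x j)) =
      ∏ p ∈ Finset.univ.filter (fun p : Fin (2 * n) × Fin (2 * n) => p.1 < p.2),
        (x p.1 - x p.2) / (x p.1 + x p.2) := by
  have hx : Function.Injective x := fun i j h => by_contra fun hij => hdist i j hij h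
  have hV : ∏ p ∈ Finset.univ.filter (fun p : Fin (2 * n) × Fin (2 * n) => p.1 < p.2),
      (x p.1 - x p.2) / (x p.1 + x p.2) = schurProd x := by
    rw [schurProd, prod_sigma']
    exact prod_bij' (fun p _ => ⟨p.1, p.2⟩) (fun p _ => (p.1, p.2)) (by simp) (by simp)
      (by simp) (by simp) (by simp)
  have key := sum_perm_inv_schurProd_mul_pairProd n x hx hsum
  have hne := schurProd_ne_zero hx hsum
  have hc : ((2 ^ n * n.factorial : ℕ) : ℂ) ≠ 0 :=
    Nat.cast_ne_zero.mpr (by positivity)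
  rw [hV, pf, inv_mul_eq_iff_eq_mul₀ hc, ← key, sum_mul]
  refine sum_congr rfl fun σ _ => ?_
  rw [schurProd_comp_perm, mul_inv, mul_right_comm, mul_right_comm _ _ (schurProd x),
    mul_inv_cancel_right₀ hne]
  refine congrArg₂ (· * ·) ?_ rfl
  rcases Int.units_eq_one_or σ.sign with h | h <;> simp [h]
end

section
/- Exponential pfaffian bound: let K be a 2×2 antisymmetric matrix kernel on ℝ with entries K_{1,1}, K_{1,2}, K_{2,2}, and suppose there are constants c > d ≥ 0 and C > 0 such that |K_{1,1}(x,y)| ≤ C e^{−cx−cy}, |K_{1,2}(x,y)| ≤ C e^{−cx+dy}, and |K_{2,2}(x,y)| ≤ C e^{dx+dy} for all x, y. Then there exist b > 0 and D > 0 such that |pf[K(x_i,x_j)]_{1≤i,j≤n}| ≤ n^{n/2} D^n e^{−b Σ_{i=1}^n x_i} for all n and all points x_1, …, x_n. -/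
/-- The `2n × 2n` block antisymmetric matrix `[K(x_i, x_j)]_{1 ≤ i,j ≤ n}`. -/
noncomputable def blockMat {X : Type*} (n : ℕ) (x : Fin n → X)
    (K : X → X → Matrix (Fin 2) (Fin 2) ℂ) : Matrix (Fin (2 * n)) (Fin (2 * n)) ℂ :=
  Matrix.of fun a b =>
    K (x ⟨a.1 / 2, by have := a.2; omega⟩) (x ⟨b.1 / 2, by have := b.2; omega⟩)
      ⟨a.1 % 2, by omega⟩ ⟨b.1 % 2, by omega⟩

open scoped ComplexOrder in
theorem Matrix.norm_det_le_one_of_rows {ι : Type*} [Fintype ι] [DecidableEq ι]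
    (M : Matrix ι ι ℂ) (hM : ∀ i, ∑ j, ‖M i j‖ ^ 2 ≤ 1) : ‖M.det‖ ≤ 1 := by
  have hP : (M * M.conjTranspose).PosSemidef := Matrix.posSemidef_self_mul_conjTranspose M
  have hdet : ((‖M.det‖ ^ 2 : ℝ) : ℂ) = ((∏ i, hP.1.eigenvalues i : ℝ) : ℂ) := by
    have h := hP.1.det_eq_prod_eigenvalues
    rw [Matrix.det_mul, Matrix.det_conjTranspose] at h
    push_cast
    rw [← Complex.mul_conj']
    exact h
  have htrace : ((∑ i, hP.1.eigenvalues i : ℝ) : ℂ) = ((∑ i, ∑ j, ‖M i j‖ ^ 2 : ℝ) : ℂ) := by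
    have h := hP.1.trace_eq_sum_eigenvalues
    push_cast
    refine h.symm.trans ?_
    simp only [Matrix.trace, Matrix.diag, Matrix.mul_apply, Matrix.conjTranspose_apply]
    exact Finset.sum_congr rfl fun i _ => Finset.sum_congr rfl fun j _ => Complex.mul_conj' _
  have hdet' := Complex.ofReal_injective hdet
  have htrace' := Complex.ofReal_injective htrace
  have hsum : ∑ i, (hP.1.eigenvalues i - 1) ≤ 0 := by
    rw [Finset.sum_sub_distrib, htrace', ← Finset.sum_sub_distrib]
    exact Finset.sum_nonpos fun i _ => sub_nonpos.2 (hM i)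
  have hsq : ‖M.det‖ ^ 2 ≤ 1 := by
    calc ‖M.det‖ ^ 2 = ∏ i, hP.1.eigenvalues i := hdet'
      _ ≤ ∏ i, Real.exp (hP.1.eigenvalues i - 1) :=
          Finset.prod_le_prod (fun i _ => hP.eigenvalues_nonneg i) fun i _ => by
            linarith [Real.add_one_le_exp (hP.1.eigenvalues i - 1)]
      _ = Real.exp (∑ i, (hP.1.eigenvalues i - 1)) := (Real.exp_sum _ _).symm
      _ ≤ 1 := Real.exp_le_one_iff.2 hsum
  exact (sq_le_one_iff₀ (norm_nonneg _)).1 hsq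

/-- **Hadamard inequality**: the determinant is at most the product of Euclidean row bounds. -/
theorem Matrix.norm_det_le_prod_of_rows {ι : Type*} [Fintype ι] [DecidableEq ι]
    (M : Matrix ι ι ℂ) (r : ι → ℝ) (hr : ∀ i, 0 < r i)
    (hM : ∀ i, ∑ j, ‖M i j‖ ^ 2 ≤ r i ^ 2) : ‖M.det‖ ≤ ∏ i, r i := by
  have hN := Matrix.norm_det_le_one_of_rows
    (Matrix.of fun i j => ((r i : ℂ)⁻¹) * M i j) fun i => by
      have : ∀ j, ‖(r i : ℂ)⁻¹ * M i j‖ ^ 2 = (r i ^ 2)⁻¹ * ‖M i j‖ ^ 2 := fun j => by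
        simp [mul_pow]
      simp only [Matrix.of_apply, this, ← Finset.mul_sum]
      rw [inv_mul_le_iff₀ (pow_pos (hr i) 2), mul_one]
      exact hM i
  have hprod : 0 < ∏ i, r i := Finset.prod_pos fun i _ => hr i
  rw [Matrix.det_mul_column, norm_mul, norm_prod] at hN
  have hnorm : ∏ i, ‖(r i : ℂ)⁻¹‖ = (∏ i, r i)⁻¹ := by
    rw [← Finset.prod_inv_distrib]
    exact Finset.prod_congr rfl fun i _ => by simp [abs_of_pos (hr i)]
  rwa [hnorm, inv_mul_le_iff₀ hprod, mul_one] at hN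

theorem Fin.prod_univ_two_mul {M : Type*} [CommMonoid M] {n : ℕ} (f : Fin (2 * n) → M) :
    ∏ r, f r = ∏ i : Fin n, f ⟨2 * i.1, by have := i.2; omega⟩ *
      f ⟨2 * i.1 + 1, by have := i.2; omega⟩ := by
  rw [← (finProdFinEquiv.trans (finCongr (mul_comm n 2))).prod_comp f, Fintype.prod_prod_type]
  refine Finset.prod_congr rfl fun i _ => ?_
  rw [Fin.prod_univ_two]
  congr 2 <;> ext <;> simp [add_comm]

theorem pf_mul_diagonal {n : ℕ} (A : Matrix (Fin (2 * n)) (Fin (2 * n)) ℂ)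
    (s : Fin (2 * n) → ℂ) :
    pf (Matrix.of fun a b => s a * A a b * s b) = (∏ a, s a) * pf A := by
  unfold pf
  rw [mul_left_comm (∏ a, s a), Finset.mul_sum _ _ (∏ a, s a)]
  congr 1
  refine Finset.sum_congr rfl fun σ _ => ?_
  rw [← Equiv.prod_comp σ s, Fin.prod_univ_two_mul,
    mul_left_comm (∏ i : Fin n, _ * _), ← Finset.prod_mul_distrib]
  congr 1
  exact Finset.prod_congr rfl fun i _ => by simp only [Matrix.of_apply]; ring

/-- The matrix whose rows `2 i` and `2 i + 1` are the basis vector `k i` and row `k i` of `A`. -/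
noncomputable def basisRowMatrix {n : ℕ} (A : Matrix (Fin (2 * n)) (Fin (2 * n)) ℂ)
    (k : Fin n → Fin (2 * n)) : Matrix (Fin (2 * n)) (Fin (2 * n)) ℂ :=
  Matrix.of fun r j =>
    if r.1 % 2 = 0 then (Pi.single (k ⟨r.1 / 2, by omega⟩) 1 : Fin (2 * n) → ℂ) j
    else A (k ⟨r.1 / 2, by omega⟩) j

theorem pf_eq_sum_det {n : ℕ} (A : Matrix (Fin (2 * n)) (Fin (2 * n)) ℂ) :
    pf A = ((2 ^ n * n.factorial : ℕ) : ℂ)⁻¹ *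
      ∑ k : Fin n → Fin (2 * n), (basisRowMatrix A k).det := by
  unfold pf
  congr 1
  simp_rw [← Matrix.det_transpose (basisRowMatrix A _), Matrix.det_apply']
  rw [Finset.sum_comm]
  refine Finset.sum_congr rfl fun σ _ => ?_
  rw [← Finset.mul_sum]
  congr 1
  have h : ∀ a b, A a b = ∑ k, (Pi.single k 1 : Fin (2 * n) → ℂ) a * A k b := fun a b => by
    simp [Pi.single_apply]
  conv_lhs => enter [2, i]; rw [h]
  rw [Finset.prod_univ_sum, Fintype.piFinset_univ]
  refine Finset.sum_congr rfl fun k _ => ?_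
  rw [Fin.prod_univ_two_mul]
  refine Finset.prod_congr rfl fun i _ => ?_
  simp only [basisRowMatrix, Matrix.transpose_apply, Matrix.of_apply]
  have h1 : (2 * i.1 + 1) / 2 = i.1 := by omega
  simp [h1]

theorem norm_det_basisRowMatrix_le {n : ℕ} {A : Matrix (Fin (2 * n)) (Fin (2 * n)) ℂ} {C : ℝ}
    (hC : 0 < C) (hA : ∀ a b, ‖A a b‖ ≤ C) (k : Fin n → Fin (2 * n)) :
    ‖(basisRowMatrix A k).det‖ ≤ (√(2 * n) * C) ^ n := by
  rcases Nat.eq_zero_or_pos n with rfl | hn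
  · simp
  have h := Matrix.norm_det_le_prod_of_rows (basisRowMatrix A k)
    (fun r => if r.1 % 2 = 0 then 1 else √(2 * n) * C)
    (fun r => by split_ifs <;> positivity) fun r => by
      by_cases hr : r.1 % 2 = 0
      · simp [basisRowMatrix, hr, Pi.single_apply, apply_ite]
      · simp only [basisRowMatrix, Matrix.of_apply, hr, if_false]
        calc _ ≤ ∑ _j : Fin (2 * n), C ^ 2 :=
              Finset.sum_le_sum fun j _ => pow_le_pow_left₀ (norm_nonneg _) (hA _ _) 2
          _ = (√(2 * n) * C) ^ 2 := by
              rw [mul_pow, Real.sq_sqrt (by positivity)]; simp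
  rw [Fin.prod_univ_two_mul] at h
  simpa using h

theorem norm_pf_le {n : ℕ} {A : Matrix (Fin (2 * n)) (Fin (2 * n)) ℂ} {C : ℝ}
    (hC : 0 < C) (hA : ∀ a b, ‖A a b‖ ≤ C) :
    ‖pf A‖ ≤ (n : ℝ) ^ ((n : ℝ) / 2) * (Real.exp 1 * √2 * C) ^ n := by
  have hsum : ‖∑ k : Fin n → Fin (2 * n), (basisRowMatrix A k).det‖ ≤
      ((2 * n : ℝ) ^ n) * (√(2 * n) * C) ^ n := by
    refine (norm_sum_le_of_le _ fun k _ => norm_det_basisRowMatrix_le hC hA k).trans_eq ?_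
    simp
  have hpow : (n : ℝ) ^ ((n : ℝ) / 2) = √n ^ n := by
    rw [Real.sqrt_eq_rpow, ← Real.rpow_mul_natCast n.cast_nonneg]
    congr 1; ring
  have hfact : (n : ℝ) ^ n / n.factorial ≤ Real.exp 1 ^ n := by
    rw [← Real.exp_nat_mul, mul_one]
    exact Real.pow_div_factorial_le_exp n n.cast_nonneg n
  rw [pf_eq_sum_det, norm_mul, norm_inv, Complex.norm_natCast, hpow]
  calc _ ≤ ((2 ^ n * n.factorial : ℕ) : ℝ)⁻¹ * (((2 * n : ℝ) ^ n) * (√(2 * n) * C) ^ n) := by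
        gcongr
    _ = ((n : ℝ) ^ n / n.factorial) * (√n ^ n * (√2 * C) ^ n) := by
        rw [Real.sqrt_mul zero_le_two]
        push_cast
        field_simp
        simp only [mul_pow]
        ring
    _ ≤ Real.exp 1 ^ n * (√n ^ n * (√2 * C) ^ n) := by gcongr
    _ = _ := by simp only [mul_pow]; ring

theorem norm_pf_le_of_weighted_entries {n : ℕ} {A : Matrix (Fin (2 * n)) (Fin (2 * n)) ℂ} {C : ℝ}
    (hC : 0 < C) (s : Fin (2 * n) → ℝ) (hs : ∀ a, 0 < s a)
    (hA : ∀ a b, ‖A a b‖ ≤ C * (s a * s b)) :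
    ‖pf A‖ ≤ (n : ℝ) ^ ((n : ℝ) / 2) * (Real.exp 1 * √2 * C) ^ n * ∏ a, s a := by
  have hs' : ∀ a, (s a : ℂ) ≠ 0 := fun a => Complex.ofReal_ne_zero.2 (hs a).ne'
  let B : Matrix (Fin (2 * n)) (Fin (2 * n)) ℂ :=
    Matrix.of fun a b => (s a : ℂ)⁻¹ * A a b * (s b : ℂ)⁻¹
  have hB : ∀ a b, ‖B a b‖ ≤ C := fun a b => by
    have h : ‖B a b‖ = ‖A a b‖ / (s a * s b) := by
      simp only [B, Matrix.of_apply, norm_mul, norm_inv, Complex.norm_of_nonneg (hs _).le]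
      field_simp
    rw [h, div_le_iff₀ (mul_pos (hs a) (hs b))]
    exact hA a b
  have hAB : A = Matrix.of fun a b => (s a : ℂ) * B a b * (s b : ℂ) := by
    ext a b
    have := hs' a
    have := hs' b
    simp only [B, Matrix.of_apply]
    field_simp
  rw [hAB, pf_mul_diagonal, norm_mul, norm_prod, mul_comm]
  simp only [Complex.norm_of_nonneg (hs _).le]
  exact mul_le_mul_of_nonneg_right (norm_pf_le hC hB) (Finset.prod_nonneg fun a _ => (hs a).le)

theorem pfaffian_exponential_bound
    (K : ℝ → ℝ → Matrix (Fin 2) (Fin 2) ℂ)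
    (hanti : ∀ x y, K x y = -(K y x).transpose)
    (c d C : ℝ) (hd : 0 ≤ d) (hcd : d < c) (hC : 0 < C)
    (h11 : ∀ x y, ‖K x y 0 0‖ ≤ C * Real.exp (-c * x - c * y))
    (h12 : ∀ x y, ‖K x y 0 1‖ ≤ C * Real.exp (-c * x + d * y))
    (h22 : ∀ x y, ‖K x y 1 1‖ ≤ C * Real.exp (d * x + d * y)) :
    ∃ b > 0, ∃ D > 0, ∀ (n : ℕ) (x : Fin n → ℝ),
      ‖pf (blockMat n x K)‖ ≤
        (n : ℝ) ^ ((n : ℝ) / 2) * D ^ n * Real.exp (-b * ∑ i, x i) := by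
  refine ⟨c - d, sub_pos.2 hcd, Real.exp 1 * √2 * C, by positivity, fun n x => ?_⟩
  let w : ℝ → Fin 2 → ℝ := fun t i => if i = 0 then Real.exp (-c * t) else Real.exp (d * t)
  have hK : ∀ y z i j, ‖K y z i j‖ ≤ C * (w y i * w z j) := by
    intro y z i j
    fin_cases i <;> fin_cases j
    · simpa [w, ← Real.exp_add, sub_eq_add_neg] using h11 y z
    · simpa [w, ← Real.exp_add] using h12 y z
    · have h : K y z 1 0 = -K z y 0 1 := by rw [hanti y z]; simp
      simpa [w, ← Real.exp_add, h, add_comm] using h12 z y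
    · simpa [w, ← Real.exp_add] using h22 y z
  have h := norm_pf_le_of_weighted_entries (A := blockMat n x K) hC
    (fun a => w (x ⟨a.1 / 2, by omega⟩) ⟨a.1 % 2, by omega⟩)
    (fun a => by dsimp only [w]; split_ifs <;> positivity) fun a b => hK _ _ _ _
  refine h.trans_eq ?_
  congr 1
  rw [Fin.prod_univ_two_mul, Finset.mul_sum, Real.exp_sum]
  refine Finset.prod_congr rfl fun i _ => ?_
  have h1 : (2 * i.1 + 1) / 2 = i.1 := by omega
  have h2 : (2 * i.1 + 1) % 2 = 1 := by omega
  simp only [w, h1, h2, Nat.mul_div_cancel_left _ two_pos, Nat.mul_mod_right]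
  simp only [Fin.zero_eta, Fin.mk_one, if_true, one_ne_zero, if_false, ← Real.exp_add]
  congr 1
  ring
end
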